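/- For every δ ∈ (0, 1/100] and c ∈ (0, 1] there exists a constant C > 0 such that the following holds for all sufficiently large n. Set λ = e^{−1} − (log n)^{−2}, ℓ = ⌈c(log n)^3⌉, for γ ∈ Γ_ℓ let F_γ = {λℓ − 1 ≤ X(γ) ≤ λℓ and M(γ) ≤ δ·log n}, and let N = Σ_{γ ∈ Γ_ℓ} 1_{F_γ}. Then for every γ ∈ Γ_ℓ: Σ_{γ' ∈ Γ_ℓ} P(F_γ ∩ F_{γ'}) ≤ P(F_γ) · ( E[N] + C·ℓ^5·n^{6δ} ). -/

import Mathlib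

open MeasureTheory ProbabilityTheory Filter Finset

namespace Paper

/-- A path of length `ℓ` in the complete graph on `Fin n`: a sequence of `ℓ+1` distinct
vertices. -/
abbrev Path (n ℓ : ℕ) := {v : Fin (ℓ + 1) → Fin n // Function.Injective v}

/-- The `i`-th edge of a path. -/
def Path.edge {n ℓ : ℕ} (γ : Path n ℓ) (i : Fin ℓ) : Sym2 (Fin n) :=
  s(γ.1 i.castSucc, γ.1 i.succ)

/-- The total weight `X(γ)` of a path. -/
noncomputable def weight {n ℓ : ℕ} (ω : Sym2 (Fin n) → ℝ) (γ : Path n ℓ) : ℝ :=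
  ∑ i : Fin ℓ, ω (γ.edge i)

/-- Partial sum of the first `k` edge weights of a path. -/
noncomputable def partialSum {n ℓ : ℕ} (ω : Sym2 (Fin n) → ℝ) (γ : Path n ℓ) (k : ℕ) : ℝ :=
  ∑ i : Fin ℓ, if (i : ℕ) < k then ω (γ.edge i) else 0

/-- The deviation `M(γ) = max_{1 ≤ k ≤ ℓ} |∑_{i=1}^k X_{e_i} - (k/ℓ) X(γ)|`. -/
noncomputable def deviation {n ℓ : ℕ} (ω : Sym2 (Fin n) → ℝ) (γ : Path n ℓ) : ℝ :=
  ⨆ k : Fin ℓ, |partialSum ω γ ((k : ℕ) + 1) - (((k : ℕ) + 1 : ℝ) / ℓ) * weight ω γ|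

/-- The law of the i.i.d. edge weights: each edge carries an exponential variable with
mean `n` (rate `1/n`). -/
noncomputable def P (n : ℕ) : Measure (Sym2 (Fin n) → ℝ) :=
  Measure.pi fun _ => expMeasure ((n : ℝ)⁻¹)

/-- `L n λ ω` : the maximal `ℓ` such that some path of length `ℓ` has weight at most `λℓ`
(`0` if there is none). -/
noncomputable def L (n : ℕ) (lam : ℝ) (ω : Sym2 (Fin n) → ℝ) : ℕ :=
  sSup {ℓ : ℕ | ∃ γ : Path n ℓ, weight ω γ ≤ lam * ℓ}

section comb
open Classical

/-- Sum of `f` over consecutive pairs of a list. -/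
def sumL {V M : Type*} [AddCommMonoid M] (f : V → V → M) : List V → M
  | [] => 0
  | [_] => 0
  | a :: b :: l => f a b + sumL f (b :: l)

theorem sumL_ofFn {V M : Type*} [AddCommMonoid M] (f : V → V → M) :
    ∀ (k : ℕ) (v : Fin (k + 1) → V),
      sumL f (List.ofFn v) = ∑ i : Fin k, f (v i.castSucc) (v i.succ)
  | 0, v => by simp [sumL]
  | k + 1, v => by
    rw [List.ofFn_succ, List.ofFn_succ, sumL, Fin.sum_univ_succ]
    have := sumL_ofFn f k (fun i => v i.succ)
    rw [List.ofFn_succ] at this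
    rw [this]
    rfl

/-- Whether the first edge of the list is in `E`. -/
def firstE {V : Type*} (E : V → V → Prop) : List V → Prop
  | a :: b :: _ => E a b
  | _ => False

/-- Number of nonshared edges. -/
noncomputable def rL {V : Type*} (E : V → V → Prop) (l : List V) : ℕ :=
  sumL (fun a b => if E a b then 0 else 1) l

/-- Number of maximal runs of shared edges. -/
noncomputable def th {V : Type*} (E : V → V → Prop) : List V → ℕ
  | [] => 0
  | [_] => 0
  | a :: b :: l => th E (b :: l) + if E a b ∧ ¬ firstE E (b :: l) then 1 else 0

theorem th_zero {V : Type*} (E : V → V → Prop) : ∀ (l : List V), th E l = 0 →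
    sumL (fun a b => if E a b then 1 else 0 : V → V → ℕ) l = 0
  | [], _ => rfl
  | [_], _ => rfl
  | a :: b :: l, h => by
    rw [th, Nat.add_eq_zero_iff] at h
    have ih := th_zero E (b :: l) h.1
    rw [sumL, ih]
    have h2 := h.2
    by_cases hE : E a b
    · exfalso
      cases l with
      | nil => simp [hE, firstE] at h2
      | cons c l =>
        simp only [sumL] at ih
        simp [hE, firstE] at h2
        simp [h2] at ih
    · simp [hE]

/-- The weight of a list. -/
noncomputable def WL {V : Type*} (E : V → V → Prop) (n x : ℝ) (l : List V) : ℝ :=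
  if l.Nodup then (n⁻¹) ^ (rL E l) * x ^ (th E l) else 0

variable {V : Type*} [Fintype V]

theorem WL_nonneg (E : V → V → Prop) {n x : ℝ} (hn : 0 < n) (hx : 1 ≤ x) (l : List V) :
    0 ≤ WL E n x l := by
  unfold WL; split_ifs <;> positivity

theorem WL_cons_not (E : V → V → Prop) {n x : ℝ} (hn : 0 < n) (hx : 1 ≤ x) (a b : V)
    (l : List V) (hE : ¬ E a b) :
    WL E n x (a :: b :: l) ≤ n⁻¹ * WL E n x (b :: l) := by
  by_cases h : (a :: b :: l).Nodup
  · have h' := (List.nodup_cons.1 h).2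
    simp only [WL, h, h', if_true, rL, sumL, th, hE, if_false, false_and]
    rw [pow_add]; simp [mul_assoc]
  · rw [WL, if_neg h]
    exact mul_nonneg (by positivity) (WL_nonneg E hn hx _)

theorem WL_cons_start (E : V → V → Prop) {n x : ℝ} (hn : 0 < n) (hx : 1 ≤ x) (a b : V)
    (l : List V) (hE : E a b) :
    WL E n x (a :: b :: l) ≤ x * WL E n x (b :: l) := by
  by_cases h : (a :: b :: l).Nodup
  · have h' := (List.nodup_cons.1 h).2
    simp only [WL, h, h', if_true, rL, sumL, th, hE]
    have : x ^ (th E (b :: l) + if True ∧ ¬ firstE E (b :: l) then 1 else 0)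
      ≤ x ^ (th E (b :: l) + 1) := by
      apply pow_le_pow_right₀ hx
      split_ifs <;> omega
    rw [zero_add]
    calc _ ≤ n⁻¹ ^ sumL (fun a b => if E a b then 0 else 1) (b :: l) * x ^ (th E (b :: l) + 1) := by
          gcongr
      _ = _ := by ring
  · rw [WL, if_neg h]
    exact mul_nonneg (by positivity) (WL_nonneg E hn hx _)

theorem WL_cons_cont (E : V → V → Prop) {n x : ℝ} (hn : 0 < n) (hx : 1 ≤ x) (a b : V)
    (l : List V) (hE : E a b) (hf : firstE E (b :: l)) :
    WL E n x (a :: b :: l) ≤ WL E n x (b :: l) := by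
  by_cases h : (a :: b :: l).Nodup
  · have h' := (List.nodup_cons.1 h).2
    simp [WL, h, h', if_true, rL, sumL, th, hE, hf]
  · rw [WL, if_neg h]
    exact (WL_nonneg E hn hx _)

theorem N1 (E : V → V → Prop) {x : ℝ} (hn : 0 < (Fintype.card V : ℝ)) (hx : 1 ≤ x)
    (b : V) (l : List V) :
    ∑ a, (if E a b then 0 else WL E (Fintype.card V) x (a :: b :: l)) ≤
      WL E (Fintype.card V) x (b :: l) := by
  calc _ ≤ ∑ a : V, (Fintype.card V : ℝ)⁻¹ * WL E (Fintype.card V) x (b :: l) := by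
        apply Finset.sum_le_sum
        intro a _
        split_ifs with h
        · exact mul_nonneg (by positivity) (WL_nonneg E hn hx _)
        · exact WL_cons_not E hn hx a b l h
    _ = _ := by
        rw [Finset.sum_const, Finset.card_univ, nsmul_eq_mul, ← mul_assoc,
          mul_inv_cancel₀ hn.ne', one_mul]

theorem N2 (E : V → V → Prop) (S : Finset V) {x : ℝ} (hn : 0 < (Fintype.card V : ℝ)) (hx : 1 ≤ x)
    (b : V) (l : List V) :
    ∑ a, (if a ∈ S ∧ ¬ E a b then WL E (Fintype.card V) x (a :: b :: l) else 0) ≤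
      (S.card / Fintype.card V : ℝ) * WL E (Fintype.card V) x (b :: l) := by
  calc _ ≤ ∑ a : V, if a ∈ S then (Fintype.card V : ℝ)⁻¹ * WL E (Fintype.card V) x (b :: l) else 0 := by
        apply Finset.sum_le_sum
        intro a _
        have := mul_nonneg (inv_nonneg.2 hn.le) (WL_nonneg E hn hx (b :: l))
        by_cases h : a ∈ S <;> by_cases h2 : E a b <;> simp only [h, h2, not_true, not_false_iff, and_true, and_false, if_true, if_false, false_and] <;> try assumption
        · exact WL_cons_not E hn hx a b l h2
        all_goals exact le_rfl
    _ = _ := by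
        rw [Finset.sum_ite_mem, Finset.univ_inter, Finset.sum_const, nsmul_eq_mul]; ring

theorem N3 (E : V → V → Prop) (hsymm : ∀ a b, E a b → E b a) (S : Finset V)
    (hS : ∀ a b, E a b → b ∈ S) (hdeg : ∀ b, (Finset.univ.filter (fun a => E a b)).card ≤ 2)
    {x : ℝ} (hn : 0 < (Fintype.card V : ℝ)) (hx : 1 ≤ x)
    (b : V) (l : List V) :
    ∑ a, (if E a b then WL E (Fintype.card V) x (a :: b :: l) else 0) ≤
      (if firstE E (b :: l) then WL E (Fintype.card V) x (b :: l) else 0) +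
      2 * x * (if b ∈ S ∧ ¬ firstE E (b :: l) then WL E (Fintype.card V) x (b :: l) else 0) := by
  set W := WL E (Fintype.card V) x with hW
  have hW0 : ∀ l, 0 ≤ W l := fun l => WL_nonneg E hn hx l
  by_cases hf : firstE E (b :: l)
  · simp only [hf, if_true, not_true, and_false, if_false, mul_zero, add_zero]
    cases l with
    | nil => simp [firstE] at hf
    | cons c l =>
      have hbc : E b c := hf
      rw [← Finset.sum_filter]
      have hc : c ∈ Finset.univ.filter (fun a => E a b) := by simp [hsymm _ _ hbc]
      rw [← Finset.add_sum_erase _ _ hc]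
      have h0 : W (c :: b :: c :: l) = 0 := by
        rw [hW, WL, if_neg]; simp
      rw [h0, zero_add]
      have hcard : ((Finset.univ.filter (fun a => E a b)).erase c).card ≤ 1 := by
        rw [Finset.card_erase_of_mem hc]; have := hdeg b; omega
      calc _ ≤ ∑ a ∈ (Finset.univ.filter (fun a => E a b)).erase c, W (b :: c :: l) := by
            apply Finset.sum_le_sum
            intro a ha
            simp at ha
            exact WL_cons_cont E hn hx a b _ ha.2 hf
        _ = ((((Finset.univ.filter (fun a => E a b)).erase c).card : ℕ) : ℝ) * W (b :: c :: l) := by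
            rw [Finset.sum_const, nsmul_eq_mul]
        _ ≤ 1 * W (b :: c :: l) := by
            gcongr
            · exact hW0 _
            · exact_mod_cast hcard
        _ = _ := one_mul _
  · simp only [hf, if_false, not_false_iff, and_true, zero_add]
    by_cases hb : b ∈ S
    · simp only [hb, if_true]
      rw [← Finset.sum_filter]
      calc _ ≤ ∑ a ∈ (Finset.univ.filter (fun a => E a b)), x * W (b :: l) := by
            apply Finset.sum_le_sum
            intro a ha
            simp at ha
            exact WL_cons_start E hn hx a b _ ha
        _ = (((Finset.univ.filter (fun a => E a b)).card : ℕ) : ℝ) * (x * W (b :: l)) := by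
            rw [Finset.sum_const, nsmul_eq_mul]
        _ ≤ 2 * (x * W (b :: l)) := by
            have := hW0 (b :: l)
            gcongr
            exact_mod_cast hdeg b
        _ = _ := by ring
    · have : ∀ a, ¬ E a b := fun a h => hb (hS a b h)
      simp [this, hb]

/-- Sum over all sequences. -/
noncomputable def SF (V : Type*) [Fintype V] (k : ℕ) (φ : List V → ℝ) : ℝ :=
  ∑ v : Fin (k + 1) → V, φ (List.ofFn v)

theorem SF_zero (φ : List V → ℝ) : SF V 0 φ = ∑ a, φ [a] := by
  unfold SF
  rw [← (Equiv.funUnique (Fin 1) V).symm.sum_comp]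
  rfl

theorem SF_succ (k : ℕ) (φ : List V → ℝ) :
    SF V (k + 1) φ = SF V k (fun t => ∑ a, φ (a :: t)) := by
  unfold SF
  rw [← (Fin.consEquiv (fun _ : Fin (k + 2) => V)).sum_comp, Fintype.sum_prod_type,
    Finset.sum_comm]
  simp [Fin.consEquiv, List.ofFn_succ]

theorem SF_mono (k : ℕ) {φ ψ : List V → ℝ} (h : ∀ b l, φ (b :: l) ≤ ψ (b :: l)) :
    SF V k φ ≤ SF V k ψ := by
  unfold SF
  apply Finset.sum_le_sum
  intro v _
  rw [List.ofFn_succ]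
  exact h _ _

theorem SF_add (k : ℕ) (φ ψ : List V → ℝ) :
    SF V k (fun t => φ t + ψ t) = SF V k φ + SF V k ψ := by
  unfold SF; rw [Finset.sum_add_distrib]

theorem SF_mul (k : ℕ) (c : ℝ) (φ : List V → ℝ) :
    SF V k (fun t => c * φ t) = c * SF V k φ := by
  unfold SF; rw [Finset.mul_sum]

/-- Whether the head of the list is in `S`. -/
def hdS (S : Finset V) : List V → Prop
  | [] => False
  | a :: _ => a ∈ S

theorem comb (E : V → V → Prop) (hsymm : ∀ a b, E a b → E b a) (S : Finset V)
    (hS : ∀ a b, E a b → b ∈ S) (hdeg : ∀ b, (Finset.univ.filter (fun a => E a b)).card ≤ 2)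
    {x : ℝ} (hn : 0 < (Fintype.card V : ℝ)) (hx : 1 ≤ x) (K : ℕ)
    (hK : 4 * x * S.card * K ^ 2 ≤ Fintype.card V) (k : ℕ) (hk : k ≤ K) :
    SF V k (WL E (Fintype.card V) x) ≤ Fintype.card V + 4 * x * S.card * k ^ 2 ∧
    SF V k (fun l => if hdS S l ∧ ¬ firstE E l then WL E (Fintype.card V) x l else 0)
      ≤ 2 * S.card ∧
    SF V k (fun l => if firstE E l then WL E (Fintype.card V) x l else 0) ≤ 4 * x * S.card * k ∧
    SF V k (fun l => if th E l = 0 then 0 else WL E (Fintype.card V) x l)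
      ≤ 4 * x * S.card * k ^ 2 := by
  have hW0 : ∀ l, 0 ≤ WL E (Fintype.card V) x l := fun l => WL_nonneg E hn hx l
  have hN1 := N1 E hn hx
  have hN2 := N2 E S hn hx
  have hN3 := N3 E hsymm S hS hdeg hn hx
  set n : ℝ := ((Fintype.card V : ℕ) : ℝ) with hndef
  set W := WL E n x with hW
  induction k with
  | zero =>
    have h1 : ∀ a : V, W [a] = 1 := by intro a; simp [hW, WL, rL, sumL, th]
    simp only [SF_zero, h1, firstE, th, hdS]
    simp [hndef]
    have : (0 : ℝ) ≤ S.card := by positivity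
    linarith
  | succ k ih =>
    obtain ⟨iT, iA, iB, iG⟩ := ih (by omega)
    have hs : (0:ℝ) ≤ 4 * x * S.card := by positivity
    have hB : SF V (k + 1) (fun l => if firstE E l then W l else 0) ≤
        SF V k (fun l => if firstE E l then W l else 0) +
        2 * x * SF V k (fun l => if hdS S l ∧ ¬ firstE E l then W l else 0) := by
      rw [SF_succ, ← SF_mul, ← SF_add]
      exact SF_mono k (fun b l => by convert hN3 b l <;> rfl)
    have hT : SF V (k + 1) W ≤ SF V k W +
        SF V (k + 1) (fun l => if firstE E l then W l else 0) := by
      rw [SF_succ, SF_succ, ← SF_add]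
      apply SF_mono k
      intro b l
      have := hN1 b l
      have e : ∑ a, W (a :: b :: l) = ∑ a, (if E a b then 0 else W (a :: b :: l)) +
        ∑ a, (if firstE E (a :: b :: l) then W (a :: b :: l) else 0) := by
        rw [← Finset.sum_add_distrib]
        apply Finset.sum_congr rfl
        intro a _
        by_cases h : E a b <;> simp [h, firstE]
      rw [e]; linarith
    have hG : SF V (k + 1) (fun l => if th E l = 0 then 0 else W l) ≤
        SF V k (fun l => if th E l = 0 then 0 else W l) +
        SF V (k + 1) (fun l => if firstE E l then W l else 0) := by
      rw [SF_succ, SF_succ, ← SF_add]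
      apply SF_mono k
      intro b l
      have e : ∑ a, (if th E (a :: b :: l) = 0 then 0 else W (a :: b :: l)) ≤
        (if th E (b :: l) = 0 then 0 else ∑ a, (if E a b then 0 else W (a :: b :: l))) +
        ∑ a, (if firstE E (a :: b :: l) then W (a :: b :: l) else 0) := by
        by_cases h0 : th E (b :: l) = 0
        · rw [if_pos h0, zero_add]
          apply Finset.sum_le_sum
          intro a _
          by_cases h : E a b
          · simp only [firstE, h, if_true]
            split_ifs
            · exact hW0 _
            · exact le_rfl
          · simp [th, h0, h, firstE]
        · rw [if_neg h0, ← Finset.sum_add_distrib]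
          apply Finset.sum_le_sum
          intro a _
          have h1 : th E (a :: b :: l) ≠ 0 := by simp [th, h0]
          rw [if_neg h1]
          by_cases h : E a b <;> simp [h, firstE]
      refine e.trans ?_
      gcongr
      split_ifs
      · exact le_rfl
      · exact hN1 b l
    have hA : SF V (k + 1) (fun l => if hdS S l ∧ ¬ firstE E l then W l else 0) ≤
        (S.card / n) * SF V k W := by
      rw [SF_succ, ← SF_mul]
      exact SF_mono k (fun b l => by convert hN2 b l <;> rfl)
    have hB' : SF V (k + 1) (fun l => if firstE E l then W l else 0) ≤
        4 * x * S.card * (k + 1) := by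
      refine hB.trans ?_
      have : 2 * x * SF V k (fun l => if hdS S l ∧ ¬ firstE E l then W l else 0) ≤
        2 * x * (2 * S.card) := by gcongr
      linarith
    have hk1 : 4 * x * S.card * (k : ℝ) ^ 2 + 4 * x * S.card * (k + 1)
        ≤ 4 * x * S.card * (k + 1 : ℝ) ^ 2 := by
      have : (0:ℝ) ≤ k := by positivity
      nlinarith [mul_nonneg hs this]
    push_cast
    refine ⟨by linarith, ?_, hB', by linarith⟩
    refine hA.trans ?_
    have h2 : SF V k W ≤ 2 * n := by
      have : 4 * x * S.card * (k : ℝ) ^ 2 ≤ 4 * x * S.card * (K : ℝ) ^ 2 := by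
        have : (k:ℝ) ≤ K := by exact_mod_cast (by omega)
        gcongr
      linarith
    calc _ ≤ (S.card / n) * (2 * n) := by gcongr
      _ = _ := by field_simp

end comb
section prob

theorem exp_lintegral {r t : ℝ} (hr : 0 < r) (ht : 0 < t) :
    ∫⁻ x, ENNReal.ofReal (Real.exp (-t * x)) ∂(expMeasure r) = ENNReal.ofReal (r / (r + t)) := by
  have hd : expMeasure r = volume.withDensity (exponentialPDF r) := rfl
  have hm : ∀ r, Measurable (exponentialPDF r) := fun r =>
    (measurable_exponentialPDFReal r).ennreal_ofReal
  rw [hd, lintegral_withDensity_eq_lintegral_mul _ (hm r) (by fun_prop)]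
  have : ∀ x, (exponentialPDF r * fun x => ENNReal.ofReal (Real.exp (-t * x))) x =
      ENNReal.ofReal (r / (r + t)) * exponentialPDF (r + t) x := by
    intro x
    simp only [Pi.mul_apply]
    rcases lt_or_ge x 0 with hx | hx
    · rw [exponentialPDF_of_neg hx, exponentialPDF_of_neg hx]; simp
    · rw [exponentialPDF_of_nonneg hx, exponentialPDF_of_nonneg hx,
        ← ENNReal.ofReal_mul (by positivity), ← ENNReal.ofReal_mul (by positivity)]
      congr 1
      rw [mul_assoc, ← Real.exp_add, ← mul_assoc, div_mul_cancel₀ _ (by positivity)]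
      congr 2; ring
  simp_rw [this]
  rw [lintegral_const_mul _ (hm _), lintegral_exponentialPDF_eq_one (by positivity), mul_one]

theorem exp_integrable {r t : ℝ} (hr : 0 < r) (ht : 0 < t) :
    Integrable (fun x => Real.exp (-t * x)) (expMeasure r) := by
  refine ⟨by fun_prop, ?_⟩
  rw [hasFiniteIntegral_iff_ofReal (ae_of_all _ fun x => (Real.exp_pos _).le),
    exp_lintegral hr ht]
  exact ENNReal.ofReal_lt_top

theorem exp_integral {r t : ℝ} (hr : 0 < r) (ht : 0 < t) :
    ∫ x, Real.exp (-t * x) ∂(expMeasure r) = r / (r + t) := by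
  rw [integral_eq_lintegral_of_nonneg_ae (ae_of_all _ fun x => (Real.exp_pos _).le) (by fun_prop),
    exp_lintegral hr ht, ENNReal.toReal_ofReal (by positivity)]

theorem chernoff {ι κ : Type*} [Fintype ι] [Finite κ] {n : ℝ} (hn : 0 < n) (g : κ → ι)
    (hg : Function.Injective g) (I : Finset κ) (s t : ℝ) (ht : 0 < t) :
    (Measure.pi fun _ : ι => expMeasure n⁻¹).real {ω | ∑ i ∈ I, ω (g i) ≤ s} ≤
      Real.exp (t * s) * ((t * n)⁻¹) ^ I.card := by
  have hp : IsProbabilityMeasure (expMeasure n⁻¹) :=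
    isProbabilityMeasure_expMeasure (inv_pos.2 hn)
  set μ := Measure.pi fun _ : ι => expMeasure n⁻¹ with hμ
  have hind : iIndepFun (fun (i : ι) (ω : ι → ℝ) => ω i) μ :=
    iIndepFun_pi (X := fun _ x => x) (fun _ => aemeasurable_id)
  have hind2 : iIndepFun (fun (i : κ) (ω : ι → ℝ) => ω (g i)) μ := hind.precomp hg
  have hmeas : ∀ i : κ, Measurable (fun (ω : ι → ℝ) => ω (g i)) := fun i => measurable_pi_apply _
  have hpres : ∀ i : ι, MeasurePreserving (fun ω : ι → ℝ => ω i) μ (expMeasure n⁻¹) :=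
    fun i => measurePreserving_eval _ i
  have hint : ∀ i : κ, Integrable (fun ω : ι → ℝ => Real.exp (-t * ω (g i))) μ := fun i =>
    (hpres (g i)).integrable_comp_of_integrable (exp_integrable (inv_pos.2 hn) ht)
  have hmgf : ∀ i : κ, mgf (fun ω : ι → ℝ => ω (g i)) μ (-t) ≤ (t * n)⁻¹ := by
    intro i
    have h1 : mgf (fun ω : ι → ℝ => ω (g i)) μ (-t) = ∫ x, Real.exp (-t * x) ∂(expMeasure n⁻¹) := by
      rw [← (hpres (g i)).map_eq, integral_map (hpres (g i)).measurable.aemeasurable (by fun_prop)]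
      rfl
    rw [h1, exp_integral (inv_pos.2 hn) ht]
    rw [mul_inv, mul_comm, div_eq_mul_inv]
    gcongr
    have := inv_pos.2 hn
    linarith
  have hX := measure_le_le_exp_mul_mgf (μ := μ) (X := ∑ i ∈ I, fun ω : ι → ℝ => ω (g i)) (t := -t)
    s (by linarith) (hind2.integrable_exp_mul_sum hmeas (fun i _ => hint i))
  rw [hind2.mgf_sum hmeas] at hX
  simp only [Finset.sum_apply, neg_neg] at hX
  refine hX.trans ?_
  gcongr
  rw [← Finset.prod_const]
  exact Finset.prod_le_prod (fun i _ => mgf_nonneg) (fun i _ => hmgf i)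

theorem indep_sets {ι : Type*} [Fintype ι] (ν : Measure ℝ) [IsProbabilityMeasure ν]
    (A B : Finset ι) (hAB : Disjoint A B) (F G : Set (ι → ℝ)) (hF : MeasurableSet F)
    (hG : MeasurableSet G) (hFA : ∀ ω ω' : ι → ℝ, (∀ i ∈ A, ω i = ω' i) → ω ∈ F → ω' ∈ F)
    (hGB : ∀ ω ω' : ι → ℝ, (∀ i ∈ B, ω i = ω' i) → ω ∈ G → ω' ∈ G) :
    (Measure.pi fun _ : ι => ν) (F ∩ G) =
      (Measure.pi fun _ : ι => ν) F * (Measure.pi fun _ : ι => ν) G := by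
  classical
  set μ := Measure.pi fun _ : ι => ν with hμ
  have hind : iIndepFun (fun (i : ι) (ω : ι → ℝ) => ω i) μ :=
    iIndepFun_pi (X := fun _ x => x) (fun _ => aemeasurable_id)
  have h := hind.indepFun_finset A B hAB (fun i => measurable_pi_apply i)
  have key : ∀ (A : Finset ι) (F : Set (ι → ℝ)), MeasurableSet F →
      (∀ ω ω' : ι → ℝ, (∀ i ∈ A, ω i = ω' i) → ω ∈ F → ω' ∈ F) →
      ∃ F' : Set (A → ℝ), MeasurableSet F' ∧ (fun (ω : ι → ℝ) (i : A) => ω i) ⁻¹' F' = F := by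
    intro A F hF hFA
    refine ⟨(fun (y : A → ℝ) (i : ι) => if h : i ∈ A then y ⟨i, h⟩ else 0) ⁻¹' F, ?_, ?_⟩
    · apply measurableSet_preimage _ hF
      apply measurable_pi_lambda
      intro i
      by_cases hi : i ∈ A
      · simp only [hi, dif_pos]; exact measurable_pi_apply _
      · simp only [hi, dif_neg, not_false_iff]; exact measurable_const
    · ext ω
      constructor
      · exact hFA _ _ (fun i hi => by simp [hi])
      · exact hFA _ _ (fun i hi => by simp [hi])
  obtain ⟨F', hF', rfl⟩ := key A F hF hFA
  obtain ⟨G', hG', rfl⟩ := key B G hG hGB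
  exact h.measure_inter_preimage_eq_mul F' G' hF' hG'
end prob
section path
open Classical

/-- Edge relation of a path given by `f` on `0..ℓ`. -/
def Ef {V : Type*} (f : ℕ → V) (ℓ : ℕ) (a b : V) : Prop :=
  ∃ i < ℓ, (a = f (i + 1) ∧ b = f i) ∨ (a = f i ∧ b = f (i + 1))

theorem Ef_symm {V : Type*} (f : ℕ → V) (ℓ : ℕ) (a b : V) (h : Ef f ℓ a b) : Ef f ℓ b a := by
  obtain ⟨i, hi, h⟩ := h
  exact ⟨i, hi, by tauto⟩

theorem Ef_deg {V : Type*} [Fintype V] (f : ℕ → V) (ℓ : ℕ)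
    (hf : ∀ i j, i ≤ ℓ → j ≤ ℓ → f i = f j → i = j) (b : V) :
    (Finset.univ.filter (fun a => Ef f ℓ a b)).card ≤ 2 := by
  by_cases hb : ∃ j ≤ ℓ, b = f j
  · obtain ⟨j, hj, rfl⟩ := hb
    refine (Finset.card_le_card (t := {f (j + 1), f (j - 1)}) ?_).trans (Finset.card_le_two)
    intro a ha
    simp only [Finset.mem_filter, Finset.mem_univ, true_and] at ha
    obtain ⟨i, hi, ⟨h1, h2⟩ | ⟨h1, h2⟩⟩ := ha
    · have := hf _ _ hj (by omega) h2
      subst this; simp [h1]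
    · have := hf _ _ hj (by omega) h2
      subst this; simp [h1]
  · have : Finset.univ.filter (fun a => Ef f ℓ a b) = ∅ := by
      ext a
      simp only [Finset.mem_filter, Finset.mem_univ, true_and, Finset.notMem_empty, iff_false]
      rintro ⟨i, hi, ⟨_, h⟩ | ⟨_, h⟩⟩
      · exact hb ⟨i, by omega, h⟩
      · exact hb ⟨i + 1, by omega, h⟩
    rw [this]; simp

theorem excess {V : Type*} (f : ℕ → V) (ℓ : ℕ)
    (hf : ∀ i j, i ≤ ℓ → j ≤ ℓ → f i = f j → i = j)
    (w : V → V → ℝ) (hw : ∀ a b, w a b = w b a) (g : ℕ → ℝ) (D m : ℝ)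
    (hg : ∀ i ≤ ℓ, |g i| ≤ D) (hgw : ∀ i < ℓ, g (i + 1) - g i = w (f i) (f (i + 1)) - m) :
    ∀ l : List V, l.Nodup →
      -(2 * D * th (Ef f ℓ) l) ≤ sumL (fun a b => if Ef f ℓ a b then w a b - m else 0) l ∧
      ∀ a b l', l = a :: b :: l' → ∀ i < ℓ,
        ((a = f (i + 1) ∧ b = f i) → -(2 * D * th (Ef f ℓ) l) + D + g (i + 1) ≤
          sumL (fun a b => if Ef f ℓ a b then w a b - m else 0) l) ∧
        ((a = f i ∧ b = f (i + 1)) → -(2 * D * th (Ef f ℓ) l) + D - g i ≤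
          sumL (fun a b => if Ef f ℓ a b then w a b - m else 0) l)
  | [], _ => by simp [th, sumL]
  | [_], _ => by simp [th, sumL]
  | a :: b :: l, hl => by
    obtain ⟨ih1, ih2⟩ := excess f ℓ hf w hw g D m hg hgw (b :: l) (List.nodup_cons.1 hl).2
    have key : ∀ i < ℓ,
        ((a = f (i + 1) ∧ b = f i) → -(2 * D * th (Ef f ℓ) (a :: b :: l)) + D + g (i + 1) ≤
          sumL (fun a b => if Ef f ℓ a b then w a b - m else 0) (a :: b :: l)) ∧
        ((a = f i ∧ b = f (i + 1)) → -(2 * D * th (Ef f ℓ) (a :: b :: l)) + D - g i ≤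
          sumL (fun a b => if Ef f ℓ a b then w a b - m else 0) (a :: b :: l)) := by
      intro i hi
      have hgi := hgw i hi
      have hb1 := abs_le.1 (hg i (by omega))
      have hb2 := abs_le.1 (hg (i + 1) (by omega))
      constructor
      · intro hab
        have hE : Ef f ℓ a b := ⟨i, hi, Or.inl hab⟩
        have hwab : w a b = w (f i) (f (i + 1)) := by rw [hab.1, hab.2, hw]
        by_cases hF : firstE (Ef f ℓ) (b :: l)
        · cases l with
          | nil => simp [firstE] at hF
          | cons c l =>
            obtain ⟨j, hj, h | h⟩ := hF
            · have hij : i = j + 1 := hf _ _ (by omega) (by omega) (hab.2.symm.trans h.1)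
              have := (ih2 b c l rfl j hj).1 h
              have hF : firstE (Ef f ℓ) (b :: c :: l) := ⟨j, hj, Or.inl h⟩
              rw [th, sumL]
              simp only [hE, hF, not_true, and_false, if_false, if_true, add_zero]
              rw [hwab]
              rw [← hij] at this
              linarith
            · exfalso
              have hij : i = j := hf _ _ (by omega) (by omega) (hab.2.symm.trans h.1)
              subst hij
              have : a = c := hab.1.trans h.2.symm
              subst this
              simp at hl
        · rw [th, sumL]
          simp only [hE, hF, not_false_iff, and_true, if_true]
          push_cast
          rw [hwab]
          linarith
      · intro hab
        have hE : Ef f ℓ a b := ⟨i, hi, Or.inr hab⟩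
        have hwab : w a b = w (f i) (f (i + 1)) := by rw [hab.1, hab.2]
        by_cases hF : firstE (Ef f ℓ) (b :: l)
        · cases l with
          | nil => simp [firstE] at hF
          | cons c l =>
            obtain ⟨j, hj, h | h⟩ := hF
            · exfalso
              have hij : i + 1 = j + 1 := hf _ _ (by omega) (by omega) (hab.2.symm.trans h.1)
              obtain rfl : i = j := by omega
              have : a = c := hab.1.trans h.2.symm
              subst this
              simp at hl
            · have hij : i + 1 = j := hf _ _ (by omega) (by omega) (hab.2.symm.trans h.1)
              have := (ih2 b c l rfl j hj).2 h
              have hF : firstE (Ef f ℓ) (b :: c :: l) := ⟨j, hj, Or.inr h⟩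
              rw [th, sumL]
              simp only [hE, hF, not_true, and_false, if_false, if_true, add_zero]
              rw [hwab]
              rw [← hij] at this
              linarith
        · rw [th, sumL]
          simp only [hE, hF, not_false_iff, and_true, if_true]
          push_cast
          rw [hwab]
          linarith
    refine ⟨?_, ?_⟩
    · by_cases hE : Ef f ℓ a b
      · obtain ⟨i, hi, h | h⟩ := hE
        · have := (key i hi).1 h
          have hb2 := abs_le.1 (hg (i + 1) (by omega))
          linarith
        · have := (key i hi).2 h
          have hb2 := abs_le.1 (hg i (by omega))
          linarith
      · rw [th, sumL]
        simp only [hE, if_false, false_and, add_zero, zero_add]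
        exact ih1
    · intro a' b' l' h
      obtain ⟨rfl, rfl, rfl⟩ : a = a' ∧ b = b' ∧ l = l' := by simpa using h
      exact key

/-- Extension of a path to a function on `ℕ`. -/
def ext {n ℓ : ℕ} (γ : Path n ℓ) (i : ℕ) : Fin n := γ.1 ⟨min i ℓ, by omega⟩

theorem ext_inj {n ℓ : ℕ} (γ : Path n ℓ) (i j : ℕ) (hi : i ≤ ℓ) (hj : j ≤ ℓ)
    (h : ext γ i = ext γ j) : i = j := by
  have := γ.2 h
  simp only [Fin.mk.injEq] at this
  omega

theorem edge_ext {n ℓ : ℕ} (γ : Path n ℓ) (i : Fin ℓ) :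
    γ.edge i = s(ext γ i, ext γ (i + 1)) := by
  unfold Path.edge ext
  congr 3 <;> (apply congrArg; ext; simp)

/-- Adjacency in `γ`. -/
def EP {n ℓ : ℕ} (γ : Path n ℓ) (a b : Fin n) : Prop := Ef (ext γ) ℓ a b

theorem EP_iff {n ℓ : ℕ} (γ : Path n ℓ) (a b : Fin n) :
    EP γ a b ↔ ∃ i, s(a, b) = γ.edge i := by
  constructor
  · rintro ⟨i, hi, h⟩
    refine ⟨⟨i, hi⟩, ?_⟩
    rw [edge_ext, Sym2.eq_iff]; tauto
  · rintro ⟨i, h⟩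
    rw [edge_ext, Sym2.eq_iff] at h
    exact ⟨i, i.2, by tauto⟩

theorem edge_inj {n ℓ : ℕ} (γ : Path n ℓ) : Function.Injective γ.edge := by
  intro i j h
  rw [edge_ext, edge_ext, Sym2.eq_iff] at h
  have hi := i.2
  have hj := j.2
  ext
  rcases h with ⟨h, _⟩ | ⟨h1, h2⟩
  · exact ext_inj γ _ _ (by omega) (by omega) h
  · have := ext_inj γ _ _ (by omega) (by omega) h1
    have := ext_inj γ _ _ (by omega) (by omega) h2
    omega

theorem partialSum_succ {n ℓ : ℕ} (ω : Sym2 (Fin n) → ℝ) (γ : Path n ℓ) (i : ℕ) (hi : i < ℓ) :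
    partialSum ω γ (i + 1) - partialSum ω γ i = ω s(ext γ i, ext γ (i + 1)) := by
  unfold partialSum
  rw [← Finset.sum_sub_distrib, Finset.sum_eq_single (⟨i, hi⟩ : Fin ℓ)]
  · simp [edge_ext]
  · intro b _ hb
    have : (b : ℕ) ≠ i := fun h => hb (Fin.ext h)
    by_cases h : (b : ℕ) < i
    · rw [if_pos (by omega), if_pos h, sub_self]
    · rw [if_neg (by omega), if_neg h, sub_self]
  · simp

theorem pathwise {n ℓ : ℕ} (hℓ : 0 < ℓ) (ω : Sym2 (Fin n) → ℝ) (γ γ' : Path n ℓ) (lam D : ℝ)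
    (hD : 0 ≤ D)
    (h1 : lam * ℓ - 1 ≤ weight ω γ) (hdev : deviation ω γ ≤ D) (h2 : weight ω γ' ≤ lam * ℓ) :
    ∑ i ∈ Finset.univ.filter (fun i : Fin ℓ => ¬ EP γ (γ'.1 i.castSucc) (γ'.1 i.succ)),
      ω (γ'.edge i) ≤ lam * (rL (EP γ) (List.ofFn γ'.1) : ℝ) + 1 +
        2 * D * th (EP γ) (List.ofFn γ'.1) := by
  have hℓ' : (0 : ℝ) < ℓ := by exact_mod_cast hℓ
  set m := weight ω γ / ℓ with hm
  have hex := (excess (ext γ) ℓ (ext_inj γ) (fun a b => ω s(a, b))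
    (fun a b => by rw [Sym2.eq_swap]) (fun i => partialSum ω γ i - (i / ℓ : ℝ) * weight ω γ) D m
    (by
      intro i hi
      cases i with
      | zero => simp [partialSum, hD]
      | succ i =>
        refine le_trans ?_ hdev
        have := le_ciSup (f := fun k : Fin ℓ =>
          |partialSum ω γ ((k : ℕ) + 1) - (((k : ℕ) + 1 : ℝ) / ℓ) * weight ω γ|)
          (Set.finite_range _).bddAbove ⟨i, by omega⟩
        unfold deviation
        push_cast
        exact this)
    (by
      intro i hi
      have := partialSum_succ ω γ i hi
      rw [← this, hm]
      push_cast
      field_simp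
      ring) (List.ofFn γ'.1) (List.nodup_ofFn.2 γ'.2)).1
  rw [sumL_ofFn] at hex
  change -(2 * D * th (EP γ) _) ≤ ∑ i : Fin ℓ, (if EP γ (γ'.1 i.castSucc) (γ'.1 i.succ) then
    ω (γ'.edge i) - m else 0) at hex
  have hr : rL (EP γ) (List.ofFn γ'.1) =
      (Finset.univ.filter (fun i : Fin ℓ => ¬ EP γ (γ'.1 i.castSucc) (γ'.1 i.succ))).card := by
    rw [rL, sumL_ofFn, Finset.card_filter]
    apply Finset.sum_congr rfl
    intro i _
    by_cases h : EP γ (γ'.1 i.castSucc) (γ'.1 i.succ) <;> simp [h]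
  set p : Fin ℓ → Prop := fun i => EP γ (γ'.1 i.castSucc) (γ'.1 i.succ) with hp
  change -(2 * D * th (EP γ) _) ≤ ∑ i : Fin ℓ, (if p i then _ else 0) at hex
  rw [← Finset.sum_filter, Finset.sum_sub_distrib, Finset.sum_const, nsmul_eq_mul] at hex
  have hw : weight ω γ' = ∑ i ∈ univ.filter p, ω (γ'.edge i) +
      ∑ i ∈ univ.filter (fun i => ¬ p i), ω (γ'.edge i) := by
    rw [Finset.sum_filter_add_sum_filter_not]; rfl
  have hc : (univ.filter p).card + (univ.filter (fun i => ¬ p i)).card = ℓ := by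
    rw [Finset.card_filter_add_card_filter_not]; simp
  rw [hr]
  have hc' : ((univ.filter p).card : ℝ) + ((univ.filter (fun i => ¬ p i)).card : ℝ) = ℓ := by
    exact_mod_cast hc
  have hmm : lam - 1 / ℓ ≤ m := by
    rw [hm, le_div_iff₀ hℓ']; field_simp; linarith
  have h3 : ((univ.filter p).card : ℝ) * (lam - 1 / ℓ) ≤ ((univ.filter p).card : ℝ) * m := by
    gcongr
  have h4 : ((univ.filter p).card : ℝ) * (1 / ℓ) ≤ 1 := by
    rw [mul_one_div, div_le_one hℓ']
    have : (0:ℝ) ≤ ((univ.filter (fun i => ¬ p i)).card : ℝ) := by positivity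
    linarith
  have h5 : lam * ((univ.filter (fun i => ¬ p i)).card : ℝ) =
      lam * ℓ - ((univ.filter p).card : ℝ) * lam := by rw [← hc']; ring
  change ∑ i ∈ univ.filter (fun i => ¬ p i), ω (γ'.edge i) ≤
    lam * ((univ.filter (fun i => ¬ p i)).card : ℝ) + 1 + _
  rw [h5]
  linarith

theorem weight_congr {n ℓ : ℕ} {ω ω' : Sym2 (Fin n) → ℝ} (γ : Path n ℓ)
    (h : ∀ i, ω (γ.edge i) = ω' (γ.edge i)) : weight ω γ = weight ω' γ := by
  simp [weight, h]

theorem deviation_congr {n ℓ : ℕ} {ω ω' : Sym2 (Fin n) → ℝ} (γ : Path n ℓ)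
    (h : ∀ i, ω (γ.edge i) = ω' (γ.edge i)) : deviation ω γ = deviation ω' γ := by
  simp [deviation, partialSum, weight, h]

theorem measurable_weight {n ℓ : ℕ} (γ : Path n ℓ) : Measurable (fun ω => weight ω γ) := by
  unfold weight; fun_prop

theorem measurable_deviation {n ℓ : ℕ} (γ : Path n ℓ) : Measurable (fun ω => deviation ω γ) := by
  unfold deviation
  apply Measurable.iSup
  intro k
  have h : Measurable (fun ω => partialSum ω γ ((k : ℕ) + 1)) := by
    unfold partialSum
    apply Finset.measurable_sum
    intro i _
    split_ifs <;> fun_prop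
  have := measurable_weight γ
  exact (h.sub (this.const_mul _)).abs

theorem pair_bound {n ℓ : ℕ} (hn : 0 < n) (hℓ : 0 < ℓ) (lam δ : ℝ) (hδ : 0 < δ)
    (hlam : lam ≤ Real.exp (-1))
    (F : Path n ℓ → Set (Sym2 (Fin n) → ℝ))
    (hF : ∀ γ, F γ = {ω | lam * ℓ - 1 ≤ weight ω γ ∧ weight ω γ ≤ lam * ℓ ∧
                         deviation ω γ ≤ δ * Real.log n})
    (γ γ' : Path n ℓ) :
    (P n (F γ ∩ F γ')).toReal ≤ (P n (F γ)).toReal * ((P n (F γ')).toReal +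
      Real.exp (Real.exp 1) * (if th (EP γ) (List.ofFn γ'.1) = 0 then 0 else
        WL (EP γ) n ((n : ℝ) ^ (6 * δ)) (List.ofFn γ'.1))) := by
  have hn' : (0 : ℝ) < n := by exact_mod_cast hn
  have hlog : 0 ≤ Real.log n := Real.log_natCast_nonneg n
  have hpr : IsProbabilityMeasure (expMeasure (n : ℝ)⁻¹) :=
    isProbabilityMeasure_expMeasure (inv_pos.2 hn')
  have : IsProbabilityMeasure (P n) := by unfold P; infer_instance
  have hmF : ∀ γ, MeasurableSet (F γ) := by
    intro γ
    rw [hF]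
    exact (measurableSet_le measurable_const (measurable_weight γ)).inter
      ((measurableSet_le (measurable_weight γ) measurable_const).inter
        (measurableSet_le (measurable_deviation γ) measurable_const))
  have hdF : ∀ γ, ∀ ω ω' : Sym2 (Fin n) → ℝ, (∀ e ∈ univ.image γ.edge, ω e = ω' e) →
      ω ∈ F γ → ω' ∈ F γ := by
    intro γ ω ω' h hω
    have h' : ∀ i, ω (γ.edge i) = ω' (γ.edge i) := fun i => h _ (by simp)
    rw [hF] at hω ⊢
    simp only [Set.mem_ofPred_eq] at hω ⊢
    rw [← weight_congr γ h', ← deviation_congr γ h']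
    exact hω
  by_cases h0 : th (EP γ) (List.ofFn γ'.1) = 0
  · rw [if_pos h0, mul_zero, add_zero]
    have hz := th_zero _ _ h0
    rw [sumL_ofFn, Finset.sum_eq_zero_iff] at hz
    have hdisj : Disjoint (univ.image γ.edge) (univ.image γ'.edge) := by
      rw [Finset.disjoint_left]
      intro e he he'
      simp only [Finset.mem_image, Finset.mem_univ, true_and] at he he'
      obtain ⟨i, rfl⟩ := he
      obtain ⟨j, hj⟩ := he'
      have := hz j (Finset.mem_univ _)
      rw [if_pos ((EP_iff γ _ _).2 ⟨i, hj⟩)] at this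
      omega
    have := indep_sets (expMeasure (n : ℝ)⁻¹) _ _ hdisj (F γ) (F γ') (hmF γ) (hmF γ')
      (hdF γ) (hdF γ')
    unfold P
    rw [this, ENNReal.toReal_mul]
  · rw [if_neg h0]
    set I := Finset.univ.filter (fun i : Fin ℓ => ¬ EP γ (γ'.1 i.castSucc) (γ'.1 i.succ)) with hI
    set r := rL (EP γ) (List.ofFn γ'.1) with hrdef
    set θ := th (EP γ) (List.ofFn γ'.1) with hθ
    set s := lam * (r : ℝ) + 1 + 2 * (δ * Real.log n) * θ with hs
    have hIr : I.card = r := by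
      rw [hrdef, rL, sumL_ofFn, hI, Finset.card_filter]
      apply Finset.sum_congr rfl
      intro i _
      by_cases h : EP γ (γ'.1 i.castSucc) (γ'.1 i.succ) <;> simp [h]
    have hsub : F γ ∩ F γ' ⊆ F γ ∩ {ω | ∑ i ∈ I, ω (γ'.edge i) ≤ s} := by
      rintro ω ⟨h1, h2⟩
      refine ⟨h1, ?_⟩
      rw [hF] at h1 h2
      exact pathwise hℓ ω γ γ' lam _ (by positivity) h1.1 h1.2.2 h2.2.1
    have hdisj : Disjoint (univ.image γ.edge) (I.image γ'.edge) := by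
      rw [Finset.disjoint_left]
      intro e he he'
      simp only [Finset.mem_image, Finset.mem_univ, true_and] at he he'
      obtain ⟨i, rfl⟩ := he
      obtain ⟨j, hjI, hj⟩ := he'
      rw [hI, Finset.mem_filter] at hjI
      exact hjI.2 ((EP_iff γ _ _).2 ⟨i, hj⟩)
    have hind := indep_sets (expMeasure (n : ℝ)⁻¹) _ _ hdisj (F γ)
      {ω | ∑ i ∈ I, ω (γ'.edge i) ≤ s} (hmF γ)
      (measurableSet_le (by fun_prop) measurable_const) (hdF γ) (by
        intro ω ω' h hω
        simp only [Set.mem_ofPred_eq] at hω ⊢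
        rw [← Finset.sum_congr rfl (fun i hi => h _ (Finset.mem_image_of_mem _ hi))]
        exact hω)
    have hch := chernoff hn' γ'.edge (edge_inj γ') I s (Real.exp 1) (Real.exp_pos 1)
    have hW : WL (EP γ) n ((n : ℝ) ^ (6 * δ)) (List.ofFn γ'.1) =
        ((n : ℝ)⁻¹) ^ r * ((n : ℝ) ^ (6 * δ)) ^ θ := by
      rw [WL, if_pos (List.nodup_ofFn.2 γ'.2)]
    have hnum : Real.exp (Real.exp 1 * s) * ((Real.exp 1 * n)⁻¹) ^ I.card ≤
        Real.exp (Real.exp 1) * (((n : ℝ)⁻¹) ^ r * ((n : ℝ) ^ (6 * δ)) ^ θ) := by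
      rw [hIr, mul_inv, mul_pow, ← Real.exp_neg, ← Real.exp_nat_mul, Real.rpow_def_of_pos hn',
        ← Real.exp_nat_mul]
      have : Real.exp (Real.exp 1 * s) * Real.exp (r * -1) ≤
          Real.exp (Real.exp 1) * Real.exp (θ * (Real.log n * (6 * δ))) := by
        rw [← Real.exp_add, ← Real.exp_add, Real.exp_le_exp, hs]
        have e1 : Real.exp 1 * lam ≤ 1 := by
          calc _ ≤ Real.exp 1 * Real.exp (-1) := by gcongr
            _ = 1 := by rw [← Real.exp_add]; simp
        have e2 : Real.exp 1 ≤ 3 := Real.exp_one_lt_d9.le.trans (by norm_num)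
        have e3 : Real.exp 1 * lam * r ≤ 1 * r := by gcongr
        have e4 : Real.exp 1 * (2 * (δ * Real.log n) * θ) ≤ 3 * (2 * (δ * Real.log n) * θ) := by
          gcongr
        nlinarith
      have h2 : (0:ℝ) ≤ ((n : ℝ)⁻¹) ^ r := by positivity
      nlinarith [mul_le_mul_of_nonneg_right this h2]
    calc (P n (F γ ∩ F γ')).toReal ≤ (P n (F γ ∩ {ω | ∑ i ∈ I, ω (γ'.edge i) ≤ s})).toReal :=
          ENNReal.toReal_mono (measure_ne_top _ _) (measure_mono hsub)
      _ = (P n (F γ)).toReal * (P n {ω | ∑ i ∈ I, ω (γ'.edge i) ≤ s}).toReal := by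
          unfold P; rw [hind, ENNReal.toReal_mul]
      _ ≤ (P n (F γ)).toReal * (Real.exp (Real.exp 1) *
            (((n : ℝ)⁻¹) ^ r * ((n : ℝ) ^ (6 * δ)) ^ θ)) := by
          gcongr
          exact hch.trans hnum
      _ ≤ _ := by
          rw [hW]
          gcongr
          have : 0 ≤ (P n (F γ')).toReal := ENNReal.toReal_nonneg
          linarith

theorem eventually_large : ∃ n₀ : ℕ, ∀ n : ℕ, n₀ ≤ n → 1 ≤ Real.log n ∧
    48 * Real.log n ^ 9 * (n : ℝ) ^ (6 / 100 : ℝ) ≤ n := by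
  have h1 : ∀ᶠ x : ℝ in atTop, 1 ≤ Real.log x := Real.tendsto_log_atTop.eventually_ge_atTop 1
  have h2 : ∀ᶠ x : ℝ in atTop, ‖Real.log x‖ ≤ 1 * ‖x ^ (5 / 100 : ℝ)‖ :=
    (isLittleO_log_rpow_atTop (by norm_num : (0:ℝ) < 5 / 100)).bound one_pos
  have h3 : ∀ᶠ x : ℝ in atTop, 48 ≤ x ^ (49 / 100 : ℝ) :=
    (tendsto_rpow_atTop (by norm_num : (0:ℝ) < 49 / 100)).eventually_ge_atTop 48
  have := tendsto_natCast_atTop_atTop (R := ℝ) |>.eventually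
    (h1.and (h2.and (h3.and (eventually_gt_atTop 0))))
  obtain ⟨n₀, hn₀⟩ := eventually_atTop.1 this
  refine ⟨n₀, fun n hn => ?_⟩
  obtain ⟨a1, a2, a3, a4⟩ := hn₀ n hn
  refine ⟨a1, ?_⟩
  rw [one_mul, Real.norm_of_nonneg (by linarith), Real.norm_of_nonneg (by positivity)] at a2
  calc 48 * Real.log n ^ 9 * (n : ℝ) ^ (6 / 100 : ℝ)
      ≤ (n : ℝ) ^ (49 / 100 : ℝ) * ((n : ℝ) ^ (5 / 100 : ℝ)) ^ 9 * (n : ℝ) ^ (6 / 100 : ℝ) := by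
        gcongr
    _ = (n : ℝ) := by
        rw [← Real.rpow_natCast, ← Real.rpow_mul a4.le, ← Real.rpow_add a4, ← Real.rpow_add a4]
        norm_num

end path

/-- Lemma 2.6 (second moment bound at the subcritical edge): with λ = e⁻¹ - (log n)⁻²,
ℓ = ⌈c (log n)³⌉, F_γ = {λℓ - 1 ≤ X(γ) ≤ λℓ, M(γ) ≤ δ log n} and N = Σ_γ 1_{F_γ},
for every γ, Σ_{γ'} P(F_γ ∩ F_{γ'}) ≤ P(F_γ)(E N + C ℓ⁵ n^{6δ}). -/
theorem second_moment (δ c : ℝ) (hδ0 : 0 < δ) (hδ : δ ≤ 1 / 100) (hc0 : 0 < c) (hc : c ≤ 1) :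
    ∃ C : ℝ, 0 < C ∧ ∃ n₀ : ℕ, ∀ n : ℕ, n₀ ≤ n →
      ∀ ℓ : ℕ, ℓ = ⌈c * (Real.log n) ^ 3⌉₊ →
      ∀ lam : ℝ, lam = Real.exp (-1) - ((Real.log n) ^ 2)⁻¹ →
      ∀ F : Path n ℓ → Set (Sym2 (Fin n) → ℝ),
        (∀ γ, F γ = {ω | lam * ℓ - 1 ≤ weight ω γ ∧ weight ω γ ≤ lam * ℓ ∧
                         deviation ω γ ≤ δ * Real.log n}) →
      ∀ γ : Path n ℓ,
        ∑ γ' : Path n ℓ, (P n (F γ ∩ F γ')).toReal ≤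
          (P n (F γ)).toReal *
            ((∫ ω, (∑ γ'' : Path n ℓ, Set.indicator (F γ'') (fun _ => (1 : ℝ)) ω) ∂(P n)) +
              C * (ℓ : ℝ) ^ 5 * (n : ℝ) ^ (6 * δ)) := by
  classical
  obtain ⟨n₀, hn₀⟩ := eventually_large
  refine ⟨8 * Real.exp (Real.exp 1), by positivity, max n₀ 1, ?_⟩
  intro n hn ℓ hℓ lam hlam F hF γ
  obtain ⟨hlog, hbig⟩ := hn₀ n (le_trans (le_max_left _ _) hn)
  have hn1 : 1 ≤ n := le_trans (le_max_right _ _) hn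
  have hn' : (0 : ℝ) < n := by exact_mod_cast hn1
  have hn1' : (1 : ℝ) ≤ n := by exact_mod_cast hn1
  have hℓ0 : 0 < ℓ := by
    rw [hℓ, Nat.ceil_pos]; positivity
  have hℓ1 : (1 : ℝ) ≤ ℓ := by exact_mod_cast hℓ0
  have hL3 : 1 ≤ Real.log n ^ 3 := one_le_pow₀ hlog
  have hℓ2 : (ℓ : ℝ) ≤ 2 * Real.log n ^ 3 := by
    have : (ℓ : ℝ) < c * Real.log n ^ 3 + 1 := by
      rw [hℓ]; exact Nat.ceil_lt_add_one (by positivity)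
    nlinarith
  have hlam' : lam ≤ Real.exp (-1) := by
    rw [hlam]; have : 0 ≤ ((Real.log n) ^ 2)⁻¹ := by positivity
    linarith
  set x : ℝ := (n : ℝ) ^ (6 * δ) with hx
  have hx1 : 1 ≤ x := Real.one_le_rpow hn1' (by positivity)
  have hx2 : x ≤ (n : ℝ) ^ (6 / 100 : ℝ) := by
    apply Real.rpow_le_rpow_of_exponent_le hn1'
    linarith
  set S : Finset (Fin n) := univ.image γ.1 with hS
  have hScard : S.card = ℓ + 1 := by
    rw [hS, Finset.card_image_of_injective _ γ.2]; simp
  have hcomb := (comb (V := Fin n) (EP γ) (Ef_symm _ _) S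
    (by
      rintro a b ⟨i, hi, ⟨_, h⟩ | ⟨_, h⟩⟩ <;> rw [h, hS] <;>
        exact Finset.mem_image_of_mem _ (Finset.mem_univ _))
    (fun b => by convert Ef_deg (ext γ) ℓ (ext_inj γ) b; rfl) (x := x) (by simpa using hn') hx1 ℓ
    (by
      rw [hScard]
      push_cast
      rw [Fintype.card_fin]
      refine le_trans ?_ hbig
      have e1 : (ℓ : ℝ) + 1 ≤ 3 * Real.log n ^ 3 := by linarith
      calc 4 * x * ((ℓ : ℝ) + 1) * (ℓ : ℝ) ^ 2 ≤
          4 * (n : ℝ) ^ (6 / 100 : ℝ) * (3 * Real.log n ^ 3) * (2 * Real.log n ^ 3) ^ 2 := by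
            gcongr
        _ = _ := by ring) ℓ le_rfl).2.2.2
  rw [hScard, Fintype.card_fin] at hcomb
  have hpr : IsProbabilityMeasure (expMeasure (n : ℝ)⁻¹) :=
    isProbabilityMeasure_expMeasure (inv_pos.2 hn')
  have : IsProbabilityMeasure (P n) := by unfold P; infer_instance
  have hmF : ∀ γ, MeasurableSet (F γ) := by
    intro γ
    rw [hF]
    exact (measurableSet_le measurable_const (measurable_weight γ)).inter
      ((measurableSet_le (measurable_weight γ) measurable_const).inter
        (measurableSet_le (measurable_deviation γ) measurable_const))
  have hEN : (∫ ω, (∑ γ'' : Path n ℓ, Set.indicator (F γ'') (fun _ => (1 : ℝ)) ω) ∂(P n)) =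
      ∑ γ' : Path n ℓ, (P n (F γ')).toReal := by
    rw [integral_finsetSum _ (fun γ'' _ => (integrable_const (1:ℝ)).indicator (hmF γ''))]
    apply Finset.sum_congr rfl
    intro γ'' _
    rw [integral_indicator_const _ (hmF γ'')]
    simp [Measure.real]
  rw [hEN]
  set φ : (Fin (ℓ + 1) → Fin n) → ℝ := fun v =>
    if th (EP γ) (List.ofFn v) = 0 then 0 else WL (EP γ) n x (List.ofFn v) with hφ
  have hφ0 : ∀ v, 0 ≤ φ v := by
    intro v
    simp only [hφ]
    split_ifs
    · exact le_rfl
    · exact WL_nonneg _ hn' hx1 _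
  have hsum : ∑ γ' : Path n ℓ, φ γ'.1 ≤ 8 * (ℓ : ℝ) ^ 5 * x := by
    have e1 : ∑ γ' : Path n ℓ, φ γ'.1 ≤ ∑ v, φ v := by
      rw [← Finset.sum_subtype (univ.filter Function.Injective) (by simp) φ]
      exact Finset.sum_le_sum_of_subset_of_nonneg (Finset.filter_subset _ _) (fun v _ _ => hφ0 v)
    have e2 : ∑ v, φ v ≤ 4 * x * ((ℓ + 1 : ℕ) : ℝ) * (ℓ : ℝ) ^ 2 := by
      unfold SF at hcomb
      convert hcomb using 3
    refine e1.trans (e2.trans ?_)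
    push_cast
    have e3 : (ℓ : ℝ) ^ 3 ≤ (ℓ : ℝ) ^ 5 := pow_le_pow_right₀ hℓ1 (by norm_num)
    calc 4 * x * ((ℓ : ℝ) + 1) * (ℓ : ℝ) ^ 2 ≤ 4 * x * ((ℓ : ℝ) + ℓ) * (ℓ : ℝ) ^ 2 := by gcongr
      _ = 8 * x * (ℓ : ℝ) ^ 3 := by ring
      _ ≤ 8 * x * (ℓ : ℝ) ^ 5 := by gcongr
      _ = _ := by ring
  calc ∑ γ' : Path n ℓ, (P n (F γ ∩ F γ')).toReal
      ≤ ∑ γ' : Path n ℓ, (P n (F γ)).toReal * ((P n (F γ')).toReal +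
          Real.exp (Real.exp 1) * φ γ'.1) := by
        apply Finset.sum_le_sum
        intro γ' _
        convert pair_bound hn1 hℓ0 lam δ hδ0 hlam' F hF γ γ' using 1
    _ = (P n (F γ)).toReal * (∑ γ' : Path n ℓ, (P n (F γ')).toReal +
          Real.exp (Real.exp 1) * ∑ γ' : Path n ℓ, φ γ'.1) := by
        rw [← Finset.mul_sum, Finset.sum_add_distrib, Finset.mul_sum]
    _ ≤ _ := by
        have e5 : Real.exp (Real.exp 1) * ∑ γ' : Path n ℓ, φ γ'.1 ≤
            8 * Real.exp (Real.exp 1) * (ℓ : ℝ) ^ 5 * x := by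
          calc Real.exp (Real.exp 1) * ∑ γ' : Path n ℓ, φ γ'.1 ≤
              Real.exp (Real.exp 1) * (8 * (ℓ : ℝ) ^ 5 * x) := by gcongr
            _ = _ := by ring
        exact mul_le_mul_of_nonneg_left (by linarith) ENNReal.toReal_nonneg

end Paper
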